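/- For each s ∈ (0, ∞) there exists a constant C_s < ∞ (with C_s = 1 when s ≥ 1) such that the following holds. Let (Ω, F, P) be a probability space, let (E, S, μ) be a σ-finite measure space, let θ : E → (0, ∞) be measurable with ∫_E θ dμ < ∞, and let X : E × Ω → ℝ be jointly measurable such that for every z ∈ E, E[exp((θ(z)⁻¹ max(X(z,·),0))^s)] ≤ 2, and such that for P-almost every ω the function z ↦ X(z, ω) is μ-integrable. Then the random variable Y(ω) := ∫_E X(z, ω) dμ(z) satisfies E[exp(((C_s ∫_E θ dμ)⁻¹ max(Y,0))^s)] ≤ 2. -/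

import Mathlib

open MeasureTheory

/-- For `0 < s < 1`, the function `x ↦ exp (x ^ s)` is convex beyond its inflection point. -/
lemma convexOn_exp_rpow_of_lt_one {s K : ℝ} (hs : 0 < s) (hs1 : s < 1) (hK : 0 < K)
    (hKs : (1 - s) / s ≤ K ^ s) :
    ConvexOn ℝ (Set.Ici K) (fun x : ℝ => Real.exp (x ^ s)) := by
  have hderiv : ∀ x : ℝ, 0 < x →
      HasDerivAt (fun x : ℝ => Real.exp (x ^ s)) (Real.exp (x ^ s) * (s * x ^ (s - 1))) x :=
    fun x hx => (Real.hasDerivAt_rpow_const (Or.inl hx.ne')).exp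
  apply MonotoneOn.convexOn_of_deriv (convex_Ici K)
  · intro x hx
    exact (hderiv x (hK.trans_le hx)).continuousAt.continuousWithinAt
  · intro x hx
    rw [interior_Ici] at hx
    exact (hderiv x (hK.trans hx)).differentiableAt.differentiableWithinAt
  · rw [interior_Ici]
    intro x hx y hy hxy
    have hx0 : 0 < x := hK.trans hx
    have hy0 : 0 < y := hK.trans hy
    rw [(hderiv x hx0).deriv, (hderiv y hy0).deriv]
    have key : ∀ z : ℝ, 0 < z → Real.exp (z ^ s) * (s * z ^ (s - 1)) =
        s * Real.exp (z ^ s - (1 - s) * Real.log z) := by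
      intro z hz
      rw [Real.rpow_def_of_pos hz (s - 1), mul_left_comm, ← Real.exp_add]
      ring_nf
    rw [key x hx0, key y hy0]
    gcongr s * Real.exp ?_
    have hxs : 0 < x ^ s := Real.rpow_pos_of_pos hx0 s
    have hys : 0 < y ^ s := Real.rpow_pos_of_pos hy0 s
    have hle : x ^ s ≤ y ^ s := Real.rpow_le_rpow hx0.le hxy hs.le
    have hKx : (1 - s) / s ≤ x ^ s :=
      hKs.trans (Real.rpow_le_rpow hK.le (le_of_lt hx) hs.le)
    have hlog : s * (Real.log y - Real.log x) ≤ y ^ s / x ^ s - 1 := by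
      have h := Real.log_le_sub_one_of_pos (div_pos hys hxs)
      rw [Real.log_div hys.ne' hxs.ne', Real.log_rpow hx0, Real.log_rpow hy0] at h
      linarith
    have hq : 0 ≤ y ^ s / x ^ s - 1 := by
      rw [sub_nonneg, one_le_div hxs]
      exact hle
    have h1 : (1 - s) * (Real.log y - Real.log x) =
        (1 - s) / s * (s * (Real.log y - Real.log x)) := by
      field_simp
    have h2 : (1 - s) / s * (s * (Real.log y - Real.log x)) ≤
        x ^ s * (y ^ s / x ^ s - 1) :=
      (mul_le_mul_of_nonneg_left hlog (div_nonneg (by linarith) hs.le)).trans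
        (mul_le_mul_of_nonneg_right hKx hq)
    have h3 : x ^ s * (y ^ s / x ^ s - 1) = y ^ s - x ^ s := by
      field_simp
    linarith

lemma convexOn_exp_rpow_of_one_le {s : ℝ} (hs : 1 ≤ s) :
    ConvexOn ℝ (Set.Ici 0) (fun x : ℝ => Real.exp (x ^ s)) := by
  refine ⟨convex_Ici 0, fun x hx y hy a b ha hb hab => ?_⟩
  exact (Real.exp_le_exp.2 ((convexOn_rpow hs).2 hx hy ha hb hab)).trans
    (convexOn_exp.2 (Set.mem_univ _) (Set.mem_univ _) ha hb hab)

lemma exists_convexOn_exp_rpow_Ici {s : ℝ} (hs : 0 < s) :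
    ∃ K : ℝ, 0 ≤ K ∧ (1 ≤ s → K = 0) ∧
      ConvexOn ℝ (Set.Ici K) (fun x : ℝ => Real.exp (x ^ s)) ∧
      ∀ x : ℝ, 0 ≤ x → (x + K) ^ s ≤ x ^ s + K ^ s := by
  rcases le_or_gt 1 s with h | h
  · refine ⟨0, le_rfl, fun _ => rfl, convexOn_exp_rpow_of_one_le h, fun x _ => ?_⟩
    simp [Real.zero_rpow hs.ne']
  · have ha : 0 < (1 - s) / s := div_pos (by linarith) hs
    refine ⟨((1 - s) / s) ^ s⁻¹, by positivity, fun h' => absurd h' (not_le.2 h), ?_, ?_⟩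
    · apply convexOn_exp_rpow_of_lt_one hs h (by positivity)
      rw [Real.rpow_inv_rpow ha.le hs.ne']
    · intro x hx
      exact Real.rpow_add_le_add_rpow hx (by positivity) hs.le h.le

/-- Jensen's inequality for `x ↦ exp (x ^ s)`, with no integrability required of the composition. -/
lemma ofReal_exp_integral_rpow_le_lintegral {E : Type*} [MeasurableSpace E] {ν : Measure E}
    [IsProbabilityMeasure ν] {s K : ℝ} (hs : 0 < s)
    (hconv : ConvexOn ℝ (Set.Ici K) (fun x : ℝ => Real.exp (x ^ s)))
    {f : E → ℝ} (hf : Measurable f) (hfi : Integrable f ν) (hfK : ∀ z, K ≤ f z) :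
    ENNReal.ofReal (Real.exp ((∫ z, f z ∂ν) ^ s)) ≤
      ∫⁻ z, ENNReal.ofReal (Real.exp (f z ^ s)) ∂ν := by
  by_cases htop : ∫⁻ z, ENNReal.ofReal (Real.exp (f z ^ s)) ∂ν = ⊤
  · rw [htop]
    exact le_top
  have hmeas : Measurable fun z => Real.exp (f z ^ s) := (hf.pow_const s).exp
  have hint : Integrable (fun z => Real.exp (f z ^ s)) ν :=
    (lintegral_ofReal_ne_top_iff_integrable hmeas.aestronglyMeasurable
      (Filter.Eventually.of_forall fun z => (Real.exp_pos _).le)).1 htop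
  rw [← ofReal_integral_eq_lintegral_ofReal hint
    (Filter.Eventually.of_forall fun z => (Real.exp_pos _).le)]
  apply ENNReal.ofReal_le_ofReal
  exact hconv.map_integral_le
    (Real.continuous_exp.comp (Real.continuous_rpow_const hs.le)).continuousOn isClosed_Ici
    (Filter.Eventually.of_forall hfK) hfi hint

lemma lintegral_rpow_le_rpow_lintegral {Ω : Type*} [MeasurableSpace Ω] {P : Measure Ω}
    [IsProbabilityMeasure P] {c : ℝ} (hc : 0 < c) (hc1 : c ≤ 1) {F : Ω → ENNReal}
    (hF : Measurable F) : ∫⁻ ω, F ω ^ c ∂P ≤ (∫⁻ ω, F ω ∂P) ^ c := by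
  have h := eLpNorm'_le_eLpNorm'_of_exponent_le hc hc1 P hF.aestronglyMeasurable
  simp only [eLpNorm', enorm_eq_self, ENNReal.rpow_one, div_one, one_div] at h
  exact (ENNReal.rpow_inv_le_iff hc).1 h

/-- A probability measure proportional to `θ μ`. -/
lemma isProbabilityMeasure_withDensity_div_integral {E : Type*} [MeasurableSpace E]
    {μ : Measure E} {θ : E → ℝ} (hθ0 : ∀ z, 0 < θ z) (hθ : Integrable θ μ)
    (hT : 0 < ∫ z, θ z ∂μ) :
    IsProbabilityMeasure (μ.withDensity fun z => ENNReal.ofReal (θ z / ∫ z, θ z ∂μ)) := by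
  refine ⟨?_⟩
  rw [withDensity_apply _ MeasurableSet.univ, Measure.restrict_univ,
    ← ofReal_integral_eq_lintegral_ofReal (hθ.div_const _)
      (Filter.Eventually.of_forall fun z => (div_pos (hθ0 z) hT).le),
    integral_div, div_self hT.ne', ENNReal.ofReal_one]

/-- The triangle inequality for the `O_s` notation: if `X(z,·) ≤ O_s(θ(z))`
for every `z`, then the integral `Y = ∫_E X(z,·) dμ(z)` satisfies `Y ≤ O_s(C_s ∫_E θ dμ)`,
where `C_s` depends only on `s` and `C_s = 1` when `s ≥ 1`. -/
theorem stmt_2 (s : ℝ) (hs : 0 < s) :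
    ∃ C : ℝ, 0 < C ∧ (1 ≤ s → C = 1) ∧
      ∀ (Ω : Type) (_ : MeasurableSpace Ω) (P : Measure Ω), IsProbabilityMeasure P →
      ∀ (E : Type) (_ : MeasurableSpace E) (μ : Measure E), SigmaFinite μ →
      ∀ (θ : E → ℝ), Measurable θ → (∀ z, 0 < θ z) → Integrable θ μ →
      ∀ (X : E → Ω → ℝ), Measurable (Function.uncurry X) →
        (∀ z : E,
          ∫⁻ ω, ENNReal.ofReal (Real.exp (((θ z)⁻¹ * max (X z ω) 0) ^ s)) ∂P ≤ 2) →
        (∀ᵐ ω ∂P, Integrable (fun z => X z ω) μ) →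
        ∫⁻ ω, ENNReal.ofReal
            (Real.exp (((C * ∫ z, θ z ∂μ)⁻¹ * max (∫ z, X z ω ∂μ) 0) ^ s)) ∂P ≤ 2 := by
  obtain ⟨K, hK0, hK1, hconv, hsub⟩ := exists_convexOn_exp_rpow_Ici hs
  have hlog2 : 0 < Real.log 2 := Real.log_pos one_lt_two
  have hKs : 0 ≤ K ^ s := Real.rpow_nonneg hK0 s
  have hD : 1 ≤ 1 + K ^ s / Real.log 2 := by
    have := div_nonneg hKs hlog2.le
    linarith
  set D : ℝ := 1 + K ^ s / Real.log 2 with hDdef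
  have hD0 : 0 < D := one_pos.trans_le hD
  have hC0 : 0 < D ^ s⁻¹ := Real.rpow_pos_of_pos hD0 _
  refine ⟨D ^ s⁻¹, hC0, fun h => ?_, ?_⟩
  · rw [hDdef, hK1 h, Real.zero_rpow hs.ne']
    simp
  intro Ω _ P _ E _ μ _ θ hθm hθ0 hθ X hX hXO hXi
  have hT0 : 0 ≤ ∫ z, θ z ∂μ := integral_nonneg fun z => (hθ0 z).le
  rcases hT0.eq_or_lt with hT | hT
  · rw [← hT]
    simp [Real.zero_rpow hs.ne']
  have hν := isProbabilityMeasure_withDensity_div_integral hθ0 hθ hT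
  set T : ℝ := ∫ z, θ z ∂μ with hTdef
  set ν : Measure E := μ.withDensity fun z => ENNReal.ofReal (θ z / T) with hνdef
  have hρm : Measurable fun z => ENNReal.ofReal (θ z / T) := (hθm.div_const T).ennreal_ofReal
  have hρtop : ∀ᵐ z ∂μ, ENNReal.ofReal (θ z / T) < ⊤ :=
    Filter.Eventually.of_forall fun z => ENNReal.ofReal_lt_top
  have hZ0 : ∀ z ω, 0 ≤ (θ z)⁻¹ * max (X z ω) 0 := fun z ω =>
    mul_nonneg (inv_nonneg.2 (hθ0 z).le) (le_max_right _ _)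
  have hZm : Measurable fun p : Ω × E => (θ p.2)⁻¹ * max (X p.2 p.1) 0 + K :=
    ((hθm.comp measurable_snd).inv.mul
      ((hX.comp measurable_swap).max measurable_const)).add_const K
  have hGm : Measurable fun p : Ω × E =>
      ENNReal.ofReal (Real.exp (((θ p.2)⁻¹ * max (X p.2 p.1) 0 + K) ^ s)) :=
    (hZm.pow_const s).exp.ennreal_ofReal
  have hsmul : ∀ z ω, (ENNReal.ofReal (θ z / T)).toReal • ((θ z)⁻¹ * max (X z ω) 0) =
      T⁻¹ * max (X z ω) 0 := by
    intro z ω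
    have := (hθ0 z).ne'
    rw [ENNReal.toReal_ofReal (div_pos (hθ0 z) hT).le, smul_eq_mul]
    field_simp
  set F : Ω → ENNReal := fun ω =>
    ∫⁻ z, ENNReal.ofReal (Real.exp (((θ z)⁻¹ * max (X z ω) 0 + K) ^ s)) ∂ν with hFdef
  have hFm : Measurable F := hGm.lintegral_prod_right'
  have hpt : ∀ᵐ ω ∂P, ENNReal.ofReal
      (Real.exp (((D ^ s⁻¹ * T)⁻¹ * max (∫ z, X z ω ∂μ) 0) ^ s)) ≤ F ω ^ D⁻¹ := by
    filter_upwards [hXi] with ω hω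
    have hpos : Integrable (fun z => max (X z ω) 0) μ := hω.pos_part
    have hZi : Integrable (fun z => (θ z)⁻¹ * max (X z ω) 0) ν := by
      rw [hνdef, integrable_withDensity_iff_integrable_smul' hρm hρtop]
      simp only [hsmul]
      exact hpos.const_mul _
    have hZint : ∫ z, (θ z)⁻¹ * max (X z ω) 0 ∂ν = T⁻¹ * ∫ z, max (X z ω) 0 ∂μ := by
      rw [hνdef, integral_withDensity_eq_integral_toReal_smul hρm hρtop]
      simp only [hsmul]
      exact integral_const_mul _ _
    have hY : max (∫ z, X z ω ∂μ) 0 ≤ ∫ z, max (X z ω) 0 ∂μ :=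
      max_le (integral_mono hω hpos fun z => le_max_left _ _)
        (integral_nonneg fun z => le_max_right _ _)
    have hJ := ofReal_exp_integral_rpow_le_lintegral (ν := ν)
      (f := fun z => (θ z)⁻¹ * max (X z ω) 0 + K) hs hconv (hZm.comp measurable_prodMk_left)
      (hZi.add (integrable_const K)) (fun z => le_add_of_nonneg_left (hZ0 z ω))
    refine le_trans ?_ (ENNReal.rpow_le_rpow hJ (inv_nonneg.2 hD0.le))
    rw [ENNReal.ofReal_rpow_of_pos (Real.exp_pos _), ← Real.exp_mul]
    apply ENNReal.ofReal_le_ofReal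
    apply Real.exp_le_exp.2
    have hY0 : 0 ≤ max (∫ z, X z ω ∂μ) 0 := le_max_right _ _
    rw [mul_inv, mul_assoc, Real.mul_rpow (inv_nonneg.2 hC0.le) (by positivity),
      Real.inv_rpow hC0.le, Real.rpow_inv_rpow hD0.le hs.ne', mul_comm]
    gcongr
    rw [integral_add hZi (integrable_const K), hZint, integral_const, probReal_univ, one_smul]
    exact (mul_le_mul_of_nonneg_left hY (inv_nonneg.2 hT.le)).trans (le_add_of_nonneg_right hK0)
  have hEF : ∫⁻ ω, F ω ∂P ≤ ENNReal.ofReal (Real.exp (K ^ s + Real.log 2)) := by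
    rw [hFdef, lintegral_lintegral_swap hGm.aemeasurable]
    refine (lintegral_mono (g := fun _ => ENNReal.ofReal (Real.exp (K ^ s + Real.log 2)))
      fun z => ?_).trans (by simp)
    calc ∫⁻ ω, ENNReal.ofReal (Real.exp (((θ z)⁻¹ * max (X z ω) 0 + K) ^ s)) ∂P
        ≤ ∫⁻ ω, ENNReal.ofReal (Real.exp (K ^ s)) *
            ENNReal.ofReal (Real.exp (((θ z)⁻¹ * max (X z ω) 0) ^ s)) ∂P := by
          refine lintegral_mono fun ω => ?_
          rw [← ENNReal.ofReal_mul (Real.exp_pos _).le, ← Real.exp_add, add_comm (K ^ s)]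
          exact ENNReal.ofReal_le_ofReal (Real.exp_le_exp.2 (hsub _ (hZ0 z ω)))
      _ = ENNReal.ofReal (Real.exp (K ^ s)) *
            ∫⁻ ω, ENNReal.ofReal (Real.exp (((θ z)⁻¹ * max (X z ω) 0) ^ s)) ∂P :=
          lintegral_const_mul' _ _ ENNReal.ofReal_ne_top
      _ ≤ ENNReal.ofReal (Real.exp (K ^ s)) * 2 := by
          gcongr
          exact hXO z
      _ = ENNReal.ofReal (Real.exp (K ^ s + Real.log 2)) := by
          rw [Real.exp_add, Real.exp_log two_pos, ENNReal.ofReal_mul (Real.exp_pos _).le]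
          simp
  calc ∫⁻ ω, ENNReal.ofReal
        (Real.exp (((D ^ s⁻¹ * T)⁻¹ * max (∫ z, X z ω ∂μ) 0) ^ s)) ∂P
      ≤ ∫⁻ ω, F ω ^ D⁻¹ ∂P := lintegral_mono_ae hpt
    _ ≤ (∫⁻ ω, F ω ∂P) ^ D⁻¹ :=
        lintegral_rpow_le_rpow_lintegral (inv_pos.2 hD0) (inv_le_one_of_one_le₀ hD) hFm
    _ ≤ ENNReal.ofReal (Real.exp (K ^ s + Real.log 2)) ^ D⁻¹ :=
        ENNReal.rpow_le_rpow hEF (inv_nonneg.2 hD0.le)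
    _ = 2 := by
        have h : (K ^ s + Real.log 2) * D⁻¹ = Real.log 2 := by
          rw [← div_eq_mul_inv, div_eq_iff hD0.ne', hDdef]
          field_simp
          ring
        rw [ENNReal.ofReal_rpow_of_pos (Real.exp_pos _), ← Real.exp_mul, h,
          Real.exp_log two_pos]
        simp
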